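/- Let C be a bounded below chain complex of projective R[x,x⁻¹]-modules that is R-finitely dominated. Then C is homotopy R[x,x⁻¹]-finite, i.e. homotopy equivalent over R[x,x⁻¹] to a bounded complex of finitely generated free R[x,x⁻¹]-modules. -/

import Mathlib

open CategoryTheory LaurentPolynomial

namespace Torus

open TensorProduct

universe v

theorem exists_int_rec {P : Type*} [AddCommGroup P] (f : ℤ → P) :
    ∃ G : ℤ → P, ∀ n, G (n + 1) = G n + f n := by
  refine ⟨fun n => ∑ i ∈ Finset.range n.toNat, f i
    - ∑ i ∈ Finset.range (-n).toNat, f (-(i + 1 : ℕ)), fun n => ?_⟩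
  dsimp only
  obtain ⟨k, rfl | rfl⟩ := n.eq_nat_or_neg
  · have h1 : ((k : ℤ) + 1).toNat = k + 1 := by omega
    have h2 : (-((k : ℤ) + 1)).toNat = 0 := by omega
    have h3 : (-(k : ℤ)).toNat = 0 := by omega
    rw [h1, h2, h3, Int.toNat_natCast, Finset.sum_range_succ]
    abel
  · cases k with
    | zero => simp
    | succ k =>
      have h1 : (-((k + 1 : ℕ) : ℤ) + 1).toNat = 0 := by omega
      have h2 : (-(-((k + 1 : ℕ) : ℤ) + 1)).toNat = k := by omega
      have h3 : (-((k + 1 : ℕ) : ℤ)).toNat = 0 := by omega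
      have h4 : (-(-((k + 1 : ℕ) : ℤ))).toNat = k + 1 := by omega
      rw [h1, h2, h3, h4, Finset.sum_range_succ]
      abel

section unbundled

variable (R : Type) [CommRing R] (M : Type v) [AddCommGroup M] [Module R M]
  [Module R[T;T⁻¹] M] [IsScalarTower R R[T;T⁻¹] M]

/-- The action of `T n` as an `R`-linear map. -/
noncomputable def act (n : ℤ) : M →ₗ[R] M := Algebra.lsmul R R M (T n : R[T;T⁻¹])

theorem act_apply (n : ℤ) (m : M) : act R M n m = (T n : R[T;T⁻¹]) • m := rfl

/-- The map `x ⊗ 1 - 1 ⊗ x`. -/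
noncomputable def psi : R[T;T⁻¹] ⊗[R] M →ₗ[R[T;T⁻¹]] R[T;T⁻¹] ⊗[R] M :=
  (T 1 : R[T;T⁻¹]) • LinearMap.id - (act R M 1).baseChange R[T;T⁻¹]

theorem psi_tmul (a : R[T;T⁻¹]) (m : M) :
    psi R M (a ⊗ₜ m) = (T 1 * a) ⊗ₜ m - a ⊗ₜ[R] ((T 1 : R[T;T⁻¹]) • m) := by
  simp [psi, act_apply, TensorProduct.smul_tmul']

/-- The counit `a ⊗ m ↦ a • m`. -/
noncomputable def eps : R[T;T⁻¹] ⊗[R] M →ₗ[R[T;T⁻¹]] M :=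
  (LinearMap.id : M →ₗ[R] M).liftBaseChange R[T;T⁻¹]

theorem eps_tmul (a : R[T;T⁻¹]) (m : M) : eps R M (a ⊗ₜ m) = a • m := by
  simp [eps]

theorem eps_surjective : Function.Surjective (eps R M) := fun m =>
  ⟨1 ⊗ₜ m, by simp [eps_tmul]⟩

theorem eps_psi : eps R M ∘ₗ psi R M = 0 := by
  ext m
  simp [psi_tmul, eps_tmul]

theorem tensor_induction {p : R[T;T⁻¹] ⊗[R] M → Prop} (t : R[T;T⁻¹] ⊗[R] M)
    (h0 : p 0) (hadd : ∀ s t, p s → p t → p (s + t))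
    (h : ∀ (n : ℤ) (m : M), p ((T n : R[T;T⁻¹]) ⊗ₜ m)) : p t := by
  induction t using TensorProduct.induction_on with
  | zero => exact h0
  | add s t hs ht => exact hadd s t hs ht
  | tmul a m =>
    induction a using LaurentPolynomial.induction_on' with
    | add a b ha hb => rw [TensorProduct.add_tmul]; exact hadd _ _ ha hb
    | C_mul_T n r =>
      have : (LaurentPolynomial.C r * T n : R[T;T⁻¹]) = r • T n := by
        rw [Algebra.smul_def]; rfl
      rw [this, TensorProduct.smul_tmul]
      exact h _ _

theorem psi_injective : Function.Injective (psi R M) := by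
  obtain ⟨G, hG⟩ := exists_int_rec (fun n : ℤ =>
    (TensorProduct.mk R R[T;T⁻¹] M (T n : R[T;T⁻¹])) ∘ₗ act R M (-n))
  let r : R[T;T⁻¹] ⊗[R] M →ₗ[R] R[T;T⁻¹] ⊗[R] M :=
    TensorProduct.lift ((AddMonoidAlgebra.basis ℤ R).constr R
      (fun n => G n ∘ₗ act R M (n - 1)))
  have hr : ∀ (n : ℤ) (m : M), r ((T n : R[T;T⁻¹]) ⊗ₜ m) = G n ((T (n - 1) : R[T;T⁻¹]) • m) := by
    intro n m
    have hb : (T n : R[T;T⁻¹]) = AddMonoidAlgebra.basis ℤ R n := by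
      rfl
    rw [TensorProduct.lift.tmul, hb, Module.Basis.constr_basis]
    rfl
  have key : ∀ t, r (psi R M t) = t := by
    intro t
    induction t using tensor_induction with
    | h0 => simp
    | hadd s t hs ht => simp [hs, ht]
    | h n m =>
      rw [psi_tmul, map_sub, ← T_add, hr, hr, add_comm 1 n, hG, add_sub_cancel_right,
        ← mul_smul, ← T_add, sub_add_cancel, LinearMap.add_apply, add_sub_cancel_left,
        LinearMap.comp_apply, act_apply, ← mul_smul, ← T_add, neg_add_cancel, T_zero, one_smul]
      rfl
  exact Function.LeftInverse.injective key

theorem psi_exact : Function.Exact (psi R M) (eps R M) := by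
  have key : ∀ t, t - 1 ⊗ₜ eps R M t ∈ LinearMap.range (psi R M) := by
    intro t
    induction t using tensor_induction with
    | h0 => simp
    | hadd s t hs ht =>
      rw [map_add, TensorProduct.tmul_add, add_sub_add_comm]
      exact add_mem hs ht
    | h n m =>
      rw [eps_tmul]
      induction n using Int.induction_on generalizing m with
      | zero => simp
      | succ n ih =>
        have := add_mem (ih ((T 1 : R[T;T⁻¹]) • m))
          (LinearMap.mem_range_self (psi R M) ((T (n : ℤ) : R[T;T⁻¹]) ⊗ₜ m))
        rw [psi_tmul, ← mul_smul, ← T_add, ← T_add, add_comm 1 (n : ℤ)] at this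
        convert this using 1
        abel
      | pred n ih =>
        have := sub_mem (ih ((T (-1) : R[T;T⁻¹]) • m))
          (LinearMap.mem_range_self (psi R M)
            ((T (-(n : ℤ) - 1) : R[T;T⁻¹]) ⊗ₜ ((T (-1) : R[T;T⁻¹]) • m)))
        rw [psi_tmul, ← mul_smul, ← mul_smul, ← T_add, ← T_add, ← T_add,
          show (1 : ℤ) + (-(n : ℤ) - 1) = -n by ring, show (1 : ℤ) + -1 = 0 by ring,
          T_zero, one_smul, show -(n : ℤ) + -1 = -n - 1 by ring] at this
        convert this using 1
        abel
  intro t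
  constructor
  · intro h
    have := key t
    rwa [h, TensorProduct.tmul_zero, sub_zero] at this
  · rintro ⟨s, rfl⟩
    exact LinearMap.congr_fun (eps_psi R M) s

theorem psi_naturality {N : Type v} [AddCommGroup N] [Module R N]
    [Module R[T;T⁻¹] N] [IsScalarTower R R[T;T⁻¹] N] (f : M →ₗ[R] N)
    (hf : ∀ m, f ((T 1 : R[T;T⁻¹]) • m) = (T 1 : R[T;T⁻¹]) • f m) :
    f.baseChange R[T;T⁻¹] ∘ₗ psi R M = psi R N ∘ₗ f.baseChange R[T;T⁻¹] := by
  ext m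
  simp [psi_tmul, hf]

theorem eps_naturality {N : Type v} [AddCommGroup N] [Module R N]
    [Module R[T;T⁻¹] N] [IsScalarTower R R[T;T⁻¹] N] (f : M →ₗ[R] N)
    (g : M →ₗ[R[T;T⁻¹]] N) (hf : ∀ m, f m = g m) :
    g ∘ₗ eps R M = eps R N ∘ₗ f.baseChange R[T;T⁻¹] := by
  ext m
  simp [eps_tmul, hf]

end unbundled

section categorical

open Limits

theorem shortExact_biprod {𝒜 : Type*} [Category* 𝒜] [Abelian 𝒜] {A B C : 𝒜} (f : A ⟶ B)
    (g : B ⟶ C) (w : f ≫ g = 0) (h : (ShortComplex.mk f g w).ShortExact) (Z : 𝒜) :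
    (ShortComplex.mk (biprod.map f (𝟙 Z)) (biprod.fst ≫ g)
      (by rw [biprod.map_fst_assoc, w, comp_zero])).ShortExact := by
  have := h.mono_f
  have := h.epi_g
  dsimp at *
  refine ShortComplex.ShortExact.mk' ?_ ?_ ?_
  · apply ShortComplex.exact_of_f_is_kernel
    refine KernelFork.IsLimit.ofι _ _ (fun {W} k hk' => biprod.lift
      (h.exact.lift (k ≫ biprod.fst) (by simpa using hk')) (k ≫ biprod.snd)) ?_ ?_
    · intro W k hk'
      dsimp
      ext
      · simpa using h.exact.lift_f (k ≫ biprod.fst) (by simpa using hk')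
      · simp
    · intro W k hk' m hm
      dsimp at hm ⊢
      ext
      · rw [← cancel_mono f]
        have := h.exact.lift_f (k ≫ biprod.fst) (by simpa using hk')
        dsimp at this
        rw [biprod.lift_fst, this, ← hm]
        simp
      · simp [← hm]
  · dsimp
    constructor
    intro W a b hab
    ext
    · rw [← cancel_mono f]
      simpa using congrArg (fun t => t ≫ biprod.fst) hab
    · simpa using congrArg (fun t => t ≫ biprod.snd) hab
  · dsimp
    infer_instance

section

variable {W : Type*} [Category* W] [Preadditive W]

theorem biprod_map_eq {A B C D : W} [HasBinaryBiproduct A C] [HasBinaryBiproduct B D]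
    (f : A ⟶ B) (k : C ⟶ D) :
    biprod.map f k = biprod.fst ≫ f ≫ biprod.inl + biprod.snd ≫ k ≫ biprod.inr := by
  ext <;> simp

theorem biprod_map_comp {A B C D A' B' : W} [HasBinaryBiproduct A C] [HasBinaryBiproduct B D]
    [HasBinaryBiproduct A' B'] (f : A ⟶ B) (k : C ⟶ D) (g : B ⟶ A') (l : D ⟶ B') :
    biprod.map f k ≫ biprod.map g l = biprod.map (f ≫ g) (k ≫ l) := by
  ext <;> simp

theorem biprod_map_id (A B : W) [HasBinaryBiproduct A B] : biprod.map (𝟙 A) (𝟙 B) = 𝟙 (A ⊞ B) := by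
  ext <;> simp

end

section

variable {V : Type*} [Category* V] [Preadditive V] [HasBinaryBiproducts V] {ι : Type*}
  {c : ComplexShape ι}

/-- Adding a fixed morphism to a homotopy. -/
noncomputable def homotopyBiprod {K L : HomologicalComplex V c} {f g : K ⟶ L} (h : Homotopy f g)
    {Z Z' : HomologicalComplex V c} (k : Z ⟶ Z') :
    Homotopy (biprod.map f k) (biprod.map g k) :=
  (Homotopy.ofEq (biprod_map_eq f k)).trans
    ((((h.compRight biprod.inl).compLeft biprod.fst).add
      (Homotopy.refl (biprod.snd ≫ k ≫ biprod.inr : K ⊞ Z ⟶ L ⊞ Z'))).trans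
        (Homotopy.ofEq (biprod_map_eq g k).symm))

/-- Adding a fixed summand to a homotopy equivalence. -/
noncomputable def homotopyEquivBiprod {K L : HomologicalComplex V c} (e : HomotopyEquiv K L)
    (Z : HomologicalComplex V c) : HomotopyEquiv (K ⊞ Z) (L ⊞ Z) where
  hom := biprod.map e.hom (𝟙 Z)
  inv := biprod.map e.inv (𝟙 Z)
  homotopyHomInvId := (Homotopy.ofEq (by rw [biprod_map_comp, Category.comp_id])).trans
    ((homotopyBiprod e.homotopyHomInvId (𝟙 Z)).trans (Homotopy.ofEq (biprod_map_id _ _)))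
  homotopyInvHomId := (Homotopy.ofEq (by rw [biprod_map_comp, Category.comp_id])).trans
    ((homotopyBiprod e.homotopyInvHomId (𝟙 Z)).trans (Homotopy.ofEq (biprod_map_id _ _)))

end

theorem cone_lemma {𝒜 : Type*} [Category* 𝒜] [Abelian 𝒜] {M C F : CochainComplex 𝒜 ℤ}
    (f : M ⟶ M) (g : M ⟶ C) (w : f ≫ g = 0) (h : (ShortComplex.mk f g w).ShortExact)
    (e : HomotopyEquiv M F) [C.IsKProjective]
    (hF : (CochainComplex.mappingCone (e.inv ≫ f ≫ e.hom)).IsKProjective) :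
    Nonempty (HomotopyEquiv C (CochainComplex.mappingCone (e.inv ≫ f ≫ e.hom))) := by
  letI : HasDerivedCategory 𝒜 := HasDerivedCategory.standard 𝒜
  set E := CochainComplex.mappingCone (e.inv ≫ f ≫ e.hom) with hE
  let α : DerivedCategory.Q.obj M ≅ DerivedCategory.Q.obj F :=
    { hom := DerivedCategory.Q.map e.hom
      inv := DerivedCategory.Q.map e.inv
      hom_inv_id := by
        rw [← Functor.map_comp, DerivedCategory.Q_map_eq_of_homotopy _ e.homotopyHomInvId]
        simp
      inv_hom_id := by
        rw [← Functor.map_comp, DerivedCategory.Q_map_eq_of_homotopy _ e.homotopyInvHomId]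
        simp }
  have hc : DerivedCategory.Q.map f ≫ α.hom =
      α.hom ≫ DerivedCategory.Q.map (e.inv ≫ f ≫ e.hom) := by
    rw [Functor.map_comp, Functor.map_comp]
    exact (α.hom_inv_id_assoc _).symm
  let β := Pretriangulated.isoTriangleOfIso₁₂ _ _
    (DerivedCategory.triangleOfSES_distinguished h)
    (DerivedCategory.mappingCone_triangle_distinguished (e.inv ≫ f ≫ e.hom)) α α hc
  let γ : DerivedCategory.Q.obj C ≅ DerivedCategory.Q.obj E :=
    Pretriangulated.Triangle.π₃.mapIso β
  let δ : DerivedCategory.Qh.obj ((HomotopyCategory.quotient _ _).obj C) ≅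
      DerivedCategory.Qh.obj ((HomotopyCategory.quotient _ _).obj E) :=
    (DerivedCategory.quotientCompQhIso 𝒜).app C ≪≫ γ ≪≫
      ((DerivedCategory.quotientCompQhIso 𝒜).app E).symm
  obtain ⟨p, hp⟩ := (CochainComplex.IsKProjective.Qh_map_bijective C
    ((HomotopyCategory.quotient _ _).obj E)).surjective δ.hom
  obtain ⟨q, hq⟩ := (CochainComplex.IsKProjective.Qh_map_bijective E
    ((HomotopyCategory.quotient _ _).obj C)).surjective δ.inv
  refine ⟨HomotopyCategory.homotopyEquivOfIso ⟨p, q, ?_, ?_⟩⟩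
  · apply (CochainComplex.IsKProjective.Qh_map_bijective C _).injective
    rw [Functor.map_comp, hp, hq, δ.hom_inv_id, CategoryTheory.Functor.map_id]
  · apply (CochainComplex.IsKProjective.Qh_map_bijective E _).injective
    rw [Functor.map_comp, hp, hq, δ.inv_hom_id, CategoryTheory.Functor.map_id]

section

variable {V : Type*} [Category* V] [Preadditive V]

/-- Restriction of homotopies from chain complexes to cochain complexes. -/
def homotopyUp {K L : ChainComplex V ℤ} {f g : K ⟶ L} (h : Homotopy f g) :
    Homotopy (HomologicalComplex.restrictionMap f ComplexShape.embeddingUpIntDownInt)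
      (HomologicalComplex.restrictionMap g ComplexShape.embeddingUpIntDownInt) where
  hom p q := h.hom (-p) (-q)
  zero p q hpq := by
    apply h.zero
    change ¬ (_ + 1 = _) at hpq
    change ¬ (_ + 1 = _)
    lia
  comm n := by
    refine (h.comm (-n)).trans (congrArg₂ (· + ·) (congrArg₂ (· + ·) ?_ ?_) rfl)
    · exact (dNext_eq _ (i' := -(n + 1)) (by change _ + 1 = _; lia)).trans
        (Eq.symm (dNext_eq _ (i' := n + 1) (by simp)))
    · exact (prevD_eq _ (j' := -(n - 1)) (by change _ + 1 = _; lia)).trans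
        (Eq.symm (prevD_eq _ (j' := n - 1) (by simp)))

/-- Restriction of homotopies from cochain complexes to chain complexes. -/
def homotopyDown {K L : CochainComplex V ℤ} {f g : K ⟶ L} (h : Homotopy f g) :
    Homotopy (HomologicalComplex.restrictionMap f ComplexShape.embeddingDownIntUpInt)
      (HomologicalComplex.restrictionMap g ComplexShape.embeddingDownIntUpInt) where
  hom p q := h.hom (-p) (-q)
  zero p q hpq := by
    apply h.zero
    change ¬ (_ + 1 = _) at hpq
    change ¬ (_ + 1 = _)
    lia
  comm n := by
    refine (h.comm (-n)).trans (congrArg₂ (· + ·) (congrArg₂ (· + ·) ?_ ?_) rfl)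
    · exact (dNext_eq _ (i' := -(n - 1)) (by change _ + 1 = _; lia)).trans
        (Eq.symm (dNext_eq _ (i' := n - 1) (by simp)))
    · exact (prevD_eq _ (j' := -(n + 1)) (by change _ + 1 = _; lia)).trans
        (Eq.symm (prevD_eq _ (j' := n + 1) (by simp)))

/-- Restriction of homotopy equivalences from chain complexes to cochain complexes. -/
def homotopyEquivUp {K L : ChainComplex V ℤ} (e : HomotopyEquiv K L) :
    HomotopyEquiv (K.restriction ComplexShape.embeddingUpIntDownInt)
      (L.restriction ComplexShape.embeddingUpIntDownInt) where
  hom := HomologicalComplex.restrictionMap e.hom _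
  inv := HomologicalComplex.restrictionMap e.inv _
  homotopyHomInvId := homotopyUp e.homotopyHomInvId
  homotopyInvHomId := homotopyUp e.homotopyInvHomId

/-- Restriction of homotopy equivalences from cochain complexes to chain complexes. -/
def homotopyEquivDown {K L : CochainComplex V ℤ} (e : HomotopyEquiv K L) :
    HomotopyEquiv (K.restriction ComplexShape.embeddingDownIntUpInt)
      (L.restriction ComplexShape.embeddingDownIntUpInt) where
  hom := HomologicalComplex.restrictionMap e.hom _
  inv := HomologicalComplex.restrictionMap e.inv _
  homotopyHomInvId := homotopyDown e.homotopyHomInvId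
  homotopyInvHomId := homotopyDown e.homotopyInvHomId

end

end categorical


section final

open Limits

variable (R : Type) [CommRing R]

/-- Base change to Laurent polynomials. -/
noncomputable def extF : ModuleCat.{v} R ⥤ ModuleCat.{v} R[T;T⁻¹] where
  obj M := ModuleCat.of R[T;T⁻¹] (R[T;T⁻¹] ⊗[R] M)
  map f := ModuleCat.ofHom (f.hom.baseChange R[T;T⁻¹])
  map_id M := by
    ext : 1
    exact LinearMap.baseChange_id
  map_comp f g := by
    ext : 1
    exact LinearMap.baseChange_comp _ _

instance : (extF.{v} R).Additive where
  map_add {M N f g} := by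
    ext : 1
    exact LinearMap.baseChange_add _ _

/-- Restriction of scalars. -/
noncomputable abbrev resF : ModuleCat.{v} R[T;T⁻¹] ⥤ ModuleCat.{v} R :=
  ModuleCat.restrictScalars (algebraMap R R[T;T⁻¹])

noncomputable instance instModRes (M : ModuleCat.{v} R[T;T⁻¹]) : Module R[T;T⁻¹] ((resF R).obj M) :=
  inferInstanceAs (Module R[T;T⁻¹] M)

instance instTowerRes (M : ModuleCat.{v} R[T;T⁻¹]) :
    IsScalarTower R R[T;T⁻¹] ((resF R).obj M) where
  smul_assoc r a m := by
    rw [Algebra.smul_def, mul_smul]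
    rfl

/-- `psi` as a natural transformation. -/
noncomputable def psiN : resF.{v} R ⋙ extF R ⟶ resF R ⋙ extF R where
  app M := ModuleCat.ofHom (psi R ((resF R).obj M))
  naturality M N f := by
    ext : 1
    exact (psi_naturality R ((resF R).obj M) (N := (resF R).obj N) ((resF R).map f).hom
      (fun m => f.hom.map_smul _ _)).symm

/-- `eps` as a natural transformation. -/
noncomputable def epsN : resF.{v} R ⋙ extF R ⟶ 𝟭 _ where
  app M := ModuleCat.ofHom (Y := M) (eps R ((resF R).obj M))
  naturality M N f := by
    ext : 1
    let g : ((resF R).obj M) →ₗ[R[T;T⁻¹]] ((resF R).obj N) := f.hom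
    exact (eps_naturality R ((resF R).obj M) (N := (resF R).obj N) ((resF R).map f).hom
      g (fun m => rfl)).symm

theorem psiN_epsN (M : ModuleCat.{v} R[T;T⁻¹]) : (psiN R).app M ≫ (epsN R).app M = 0 := by
  ext : 1
  exact eps_psi R ((resF R).obj M)

theorem psiN_epsN_shortExact (M : ModuleCat.{v} R[T;T⁻¹]) :
    (ShortComplex.mk _ _ (psiN_epsN R M)).ShortExact :=
  ModuleCat.shortComplex_shortExact _ (psi_exact R ((resF R).obj M))
    (psi_injective R ((resF R).obj M)) (eps_surjective R ((resF R).obj M))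

variable {ι : Type} {c : ComplexShape ι} (C : HomologicalComplex (ModuleCat.{v} R[T;T⁻¹]) c)

/-- The induced complex of the restriction of `C`. -/
noncomputable abbrev indRes : HomologicalComplex (ModuleCat.{v} R[T;T⁻¹]) c :=
  ((extF R).mapHomologicalComplex c).obj (((resF R).mapHomologicalComplex c).obj C)

/-- `psi` on complexes. -/
noncomputable def psiC : indRes R C ⟶ indRes R C where
  f i := (psiN R).app (C.X i)
  comm' i j _ := ((psiN R).naturality (C.d i j)).symm

/-- `eps` on complexes. -/
noncomputable def epsC : indRes R C ⟶ C where
  f i := (epsN R).app (C.X i)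
  comm' i j _ := ((epsN R).naturality (C.d i j)).symm

theorem psiC_epsC : psiC R C ≫ epsC R C = 0 := by
  ext i : 1
  exact psiN_epsN R (C.X i)

theorem psiC_epsC_shortExact : (ShortComplex.mk _ _ (psiC_epsC R C)).ShortExact :=
  HomologicalComplex.shortExact_of_degreewise_shortExact _
    (fun i => psiN_epsN_shortExact R (C.X i))

end final

section freeness

open Limits

variable {A : Type} [CommRing A]

/-- Finitely generated free modules. -/
def FF (M : ModuleCat.{v} A) : Prop := Module.Free A M ∧ Module.Finite A M

theorem FF.of_iso {M N : ModuleCat.{v} A} (e : M ≅ N) (h : FF M) : FF N := by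
  obtain ⟨_, _⟩ := h
  exact ⟨Module.Free.of_equiv e.toLinearEquiv, Module.Finite.equiv e.toLinearEquiv⟩

theorem FF.biprod {M N : ModuleCat.{v} A} (h : FF M) (h' : FF N) : FF (M ⊞ N) := by
  obtain ⟨_, _⟩ := h
  obtain ⟨_, _⟩ := h'
  refine FF.of_iso (ModuleCat.biprodIsoProd M N).symm ⟨?_, ?_⟩
  · exact inferInstanceAs (Module.Free A (M × N))
  · exact inferInstanceAs (Module.Finite A (M × N))

theorem FF.projective {M : ModuleCat.{v} A} (h : FF M) : Projective M := by
  obtain ⟨_, _⟩ := h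
  have : Module.Projective A M := inferInstance
  exact (IsProjective.iff_projective M).1 this

theorem exists_complement (P : ModuleCat.{v} A) [Module.Projective A P] [Module.Finite A P] :
    ∃ Z : ModuleCat.{v} A, FF (P ⊞ Z) ∧ (Subsingleton P → Subsingleton Z) := by
  by_cases hP : Subsingleton P
  · refine ⟨ModuleCat.of A PUnit.{v + 1}, FF.biprod ?_ ?_, fun _ => ?_⟩
    · exact ⟨inferInstance, inferInstance⟩
    · exact ⟨inferInstanceAs (Module.Free A PUnit.{v + 1}), inferInstanceAs (Module.Finite A PUnit.{v + 1})⟩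
    · exact inferInstanceAs (Subsingleton PUnit.{v + 1})
  · obtain ⟨n, f, g, hf, hg, hfg⟩ := Module.Finite.exists_comp_eq_id_of_projective A P
    refine ⟨ModuleCat.of A (ULift.{v} (LinearMap.ker f)), ?_, fun h => (hP h).elim⟩
    have e : (Fin n → A) ≃ₗ[A] P × ULift.{v} (LinearMap.ker f) := 
      { toFun x := (f x, ULift.up ⟨x - g (f x), by
          have := LinearMap.congr_fun hfg (f x)
          simp at this
          simp [this]⟩)
        invFun p := g p.1 + p.2.down.1
        map_add' x y := by
          ext : 1
          · simp
          · apply ULift.ext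
            ext : 1
            simp
            abel
        map_smul' r x := by
          ext : 1
          · simp
          · apply ULift.ext
            ext : 1
            simp [smul_sub]
        left_inv x := by simp
        right_inv := by
          rintro ⟨p, ⟨z, hz⟩⟩
          have := LinearMap.congr_fun hfg p
          have hz' : f z = 0 := hz
          simp at this
          ext : 1
          · simp [this, hz']
          · apply ULift.ext
            ext : 1
            simp [this, hz'] }
    refine FF.of_iso (ModuleCat.biprodIsoProd _ _).symm ⟨?_, ?_⟩
    · exact Module.Free.of_equiv e
    · exact Module.Finite.equiv e

end freeness

section main

open Limits

variable (R : Type) [CommRing R]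

/-- The complex with zero differential. -/
noncomputable def zeroCx {A : Type} [CommRing A] (Z : ℤ → ModuleCat.{v} A) :
    CochainComplex (ModuleCat.{v} A) ℤ where
  X := Z
  d _ _ := 0

theorem subsingleton_iff_isZero {A : Type} [CommRing A] (M : ModuleCat.{v} A) :
    IsZero M ↔ Subsingleton M := ModuleCat.isZero_iff_subsingleton

theorem cochain_version (C : CochainComplex (ModuleCat.{v} R[T;T⁻¹]) ℤ)
    (a : ℤ) (hbd : ∀ n, a < n → Subsingleton (C.X n))
    (hproj : ∀ n, Module.Projective R[T;T⁻¹] (C.X n))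
    (D : CochainComplex (ModuleCat.{v} R) ℤ)
    (a' b' : ℤ) (hbd' : ∀ n, n < a' ∨ b' < n → Subsingleton (D.X n))
    (hfg : ∀ n, Module.Finite R (D.X n)) (hproj' : ∀ n, Module.Projective R (D.X n))
    (e : HomotopyEquiv (((resF R).mapHomologicalComplex _).obj C) D) :
    ∃ E : CochainComplex (ModuleCat.{v} R[T;T⁻¹]) ℤ,
      (∃ c d : ℤ, ∀ n, n < c ∨ d < n → Subsingleton (E.X n)) ∧
      (∀ n, FF (E.X n)) ∧ Nonempty (HomotopyEquiv C E) := by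
  let F := ((extF R).mapHomologicalComplex (ComplexShape.up ℤ)).obj D
  let e₁ : HomotopyEquiv (indRes R C) F := (extF R).mapHomotopyEquiv e
  have hP : ∀ n, Module.Projective R[T;T⁻¹] (F.X n) := fun n =>
    inferInstanceAs (Module.Projective R[T;T⁻¹] (R[T;T⁻¹] ⊗[R] D.X n))
  have hFin : ∀ n, Module.Finite R[T;T⁻¹] (F.X n) := fun n =>
    inferInstanceAs (Module.Finite R[T;T⁻¹] (R[T;T⁻¹] ⊗[R] D.X n))
  have hF0 : ∀ n, n < a' ∨ b' < n → Subsingleton (F.X n) := fun n hn => by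
    have := hbd' n hn
    exact inferInstanceAs (Subsingleton (R[T;T⁻¹] ⊗[R] D.X n))
  choose Z hZ hZ0 using fun n => exists_complement (F.X n)
  let e₂ := homotopyEquivBiprod e₁ (zeroCx Z)
  have hFF : ∀ n, FF ((F ⊞ zeroCx Z).X n) := fun n =>
    FF.of_iso (HomologicalComplex.biprodXIso F (zeroCx Z) n).symm (hZ n)
  have hFZ : ∀ n, n < a' ∨ b' < n → IsZero ((F ⊞ zeroCx Z).X n) := fun n hn => by
    have h0 := hF0 n hn
    have h1 := hZ0 n h0
    refine IsZero.of_iso ?_ (HomologicalComplex.biprodXIso F (zeroCx Z) n)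
    rw [biprod_isZero_iff]
    exact ⟨(subsingleton_iff_isZero _).2 h0, (subsingleton_iff_isZero _).2 h1⟩
  let φ := e₂.inv ≫ biprod.map (psiC R C) (𝟙 (zeroCx Z)) ≫ e₂.hom
  let E := CochainComplex.mappingCone φ
  have hE : ∀ n, FF (E.X n) := fun n =>
    FF.of_iso (HomologicalComplex.homotopyCofiber.XIsoBiprod φ n (n + 1) rfl).symm
      ((hFF (n + 1)).biprod (hFF n))
  have hE0 : ∀ n, n < a' - 1 ∨ b' < n → IsZero (E.X n) := fun n hn => by
    refine IsZero.of_iso ?_ (HomologicalComplex.homotopyCofiber.XIsoBiprod φ n (n + 1) rfl)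
    rw [biprod_isZero_iff]
    exact ⟨hFZ _ (by lia), hFZ _ (by lia)⟩
  have hC' : C.IsStrictlyLE a := by
    rw [CochainComplex.isStrictlyLE_iff]
    exact fun n hn => (subsingleton_iff_isZero _).2 (hbd n hn)
  have hE' : E.IsStrictlyLE b' := by
    rw [CochainComplex.isStrictlyLE_iff]
    exact fun n hn => hE0 n (Or.inr hn)
  have (n : ℤ) : Projective (C.X n) := (IsProjective.iff_projective _).1 (hproj n)
  have (n : ℤ) : Projective (E.X n) := (hE n).projective
  have : C.IsKProjective := CochainComplex.isKProjective_of_projective C a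
  have : E.IsKProjective := CochainComplex.isKProjective_of_projective E b'
  exact ⟨E, ⟨a' - 1, b', fun n hn => (subsingleton_iff_isZero _).1 (hE0 n hn)⟩, hE,
    cone_lemma _ _ _ (shortExact_biprod _ _ _ (psiC_epsC_shortExact R C) (zeroCx Z)) e₂ this⟩

end main
end Torus

/-- A bounded below chain complex of projective `R[x,x⁻¹]`-modules that
is `R`-finitely dominated is homotopy `R[x,x⁻¹]`-finite, i.e. homotopy equivalent over
`R[x,x⁻¹]` to a bounded complex of finitely generated free `R[x,x⁻¹]`-modules. -/
theorem stmt10 (R : Type) [CommRing R]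
    (C : ChainComplex (ModuleCat (LaurentPolynomial R)) ℤ)
    (a : ℤ) (hbd : ∀ n, n < a → Subsingleton (C.X n))
    (hproj : ∀ n, Module.Projective (LaurentPolynomial R) (C.X n))
    -- `C` is `R`-finitely dominated:
    (D : ChainComplex (ModuleCat R) ℤ)
    (a' b' : ℤ) (hbd' : ∀ n, n < a' ∨ b' < n → Subsingleton (D.X n))
    (hfg : ∀ n, Module.Finite R (D.X n)) (hproj' : ∀ n, Module.Projective R (D.X n))
    (e : HomotopyEquiv
      (((ModuleCat.restrictScalars
        (algebraMap R (LaurentPolynomial R))).mapHomologicalComplex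
          (ComplexShape.down ℤ)).obj C) D) :
    ∃ E : ChainComplex (ModuleCat (LaurentPolynomial R)) ℤ,
      (∃ c d : ℤ, ∀ n, n < c ∨ d < n → Subsingleton (E.X n)) ∧
      (∀ n, Module.Finite (LaurentPolynomial R) (E.X n)) ∧
      (∀ n, Module.Free (LaurentPolynomial R) (E.X n)) ∧
      Nonempty (HomotopyEquiv C E) := by
  obtain ⟨E, ⟨c, d, hE⟩, hFF, ⟨e'⟩⟩ := Torus.cochain_version R
    (C.restriction ComplexShape.embeddingUpIntDownInt) (-a)
    (fun n hn => hbd (-n) (by lia)) (fun n => hproj (-n))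
    (D.restriction ComplexShape.embeddingUpIntDownInt) (-b') (-a')
    (fun n hn => hbd' (-n) (by lia)) (fun n => hfg (-n)) (fun n => hproj' (-n))
    (Torus.homotopyEquivUp e)
  refine ⟨E.restriction ComplexShape.embeddingDownIntUpInt, ⟨-d, -c, fun n hn => ?_⟩,
    fun n => (hFF (-n)).2, fun n => (hFF (-n)).1, ⟨?_⟩⟩
  · exact hE (-n) (by lia)
  · exact (HomotopyEquiv.ofIso ((ChainComplex.cochainComplexEquivalence _).unitIso.app C)).trans
      (Torus.homotopyEquivDown e')
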